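/- Let d ≥ 2 and let w be a weight on S^{d-1} with w(S^{d-1}) = 1 and w(B) > 0 for every nonempty spherical cap B ⊂ S^{d-1}. Suppose r ∈ (0, π] and N is a positive integer such that w(B(x, r)) ≥ 1/N for all x ∈ S^{d-1}. Then there exist constants c_d, c'_d > 0 depending only on d, a convex partition {R_1, …, R_M} of S^{d-1}, and points x_1, …, x_M ∈ S^{d-1} such that for every 1 ≤ j ≤ M: B(x_j, c'_d · r) ⊂ R_j ⊂ B(x_j, c_d · r) and N·w(R_j) is a positive integer. -/

import Mathlib

open MeasureTheory Real Set
open scoped InnerProductSpace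

noncomputable section

variable {d : ℕ}

/-- The unit sphere `S^{d-1}` of `ℝ^d`. -/
def unitSphere (d : ℕ) : Set (EuclideanSpace ℝ (Fin d)) :=
  Metric.sphere (0 : EuclideanSpace ℝ (Fin d)) 1

/-- The geodesic distance `dist(x,y) = arccos (x ⬝ y)`. -/
def gdist (x y : EuclideanSpace ℝ (Fin d)) : ℝ := Real.arccos ⟪x, y⟫_ℝ

/-- The spherical cap with center `x` and radius `r`. -/
def cap (x : EuclideanSpace ℝ (Fin d)) (r : ℝ) : Set (EuclideanSpace ℝ (Fin d)) :=
  {y ∈ unitSphere d | gdist x y ≤ r}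

/-- The surface Lebesgue measure on the unit sphere, realized as the
`(d-1)`-dimensional Hausdorff measure restricted to the sphere. -/
def sphMeasure (d : ℕ) : Measure (EuclideanSpace ℝ (Fin d)) :=
  (Measure.hausdorffMeasure ((d : ℝ) - 1)).restrict (unitSphere d)

/-- `w(A) = ∫_A w dσ_d`. -/
def wMass (w : EuclideanSpace ℝ (Fin d) → ℝ) (A : Set (EuclideanSpace ℝ (Fin d))) : ℝ :=
  ∫ x in A, w x ∂(sphMeasure d)

/-- Evaluation of a `d`-variate real polynomial at a point of `ℝ^d`. -/
def pEval (P : MvPolynomial (Fin d) ℝ) (x : EuclideanSpace ℝ (Fin d)) : ℝ :=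
  MvPolynomial.eval (fun i => x i) P

/-- The geodesic arc joining `x` and `y`. -/
def arcSeg (x y : EuclideanSpace ℝ (Fin d)) : Set (EuclideanSpace ℝ (Fin d)) :=
  {z ∈ unitSphere d | ∃ t₁ t₂ : ℝ, 0 ≤ t₁ ∧ 0 ≤ t₂ ∧ z = t₁ • x + t₂ • y}

/-- Geodesic convexity of a subset of the sphere. -/
def GeoConvex (A : Set (EuclideanSpace ℝ (Fin d))) : Prop :=
  ∀ x ∈ A, ∀ y ∈ A, arcSeg x y ⊆ A

/-- The interior of a subset of the sphere relative to the sphere. -/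
def sphInterior (A : Set (EuclideanSpace ℝ (Fin d))) : Set (EuclideanSpace ℝ (Fin d)) :=
  {x ∈ A | ∃ ε : ℝ, 0 < ε ∧ Metric.ball x ε ∩ unitSphere d ⊆ A}

/-- The geodesic simplex spanned by `ξ 0, …, ξ (d-1)`. -/
def geodSimplex (ξ : Fin d → EuclideanSpace ℝ (Fin d)) :
    Set (EuclideanSpace ℝ (Fin d)) :=
  {z | ∃ t : Fin d → ℝ, (∀ j, 0 ≤ t j) ∧ (∑ j, t j) = 1 ∧
    z = ‖∑ j, t j • ξ j‖⁻¹ • ∑ j, t j • ξ j}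

/-- An admissible family `ξ 0, …, ξ (d-1)` of points of the sphere (the indices
`0, 1, …, d-1` correspond to `ξ_1, ξ_2, …, ξ_d` in the paper). -/
def Admissible (ξ : Fin d → EuclideanSpace ℝ (Fin d)) : Prop :=
  LinearIndependent ℝ ξ ∧ (∀ j, ξ j ∈ unitSphere d) ∧
  (∀ i j : Fin d, 1 ≤ (i : ℕ) → 1 ≤ (j : ℕ) → i ≠ j → ⟪ξ i, ξ j⟫_ℝ = 0) ∧
  (∀ i j : Fin d, (i : ℕ) = 0 → (j : ℕ) = 1 →
    Real.arccos ⟪ξ i, ξ j⟫_ℝ ∈ Set.Icc (π / 6) (π / 2)) ∧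
  (∀ i j : Fin d, (i : ℕ) = 0 → 2 ≤ (j : ℕ) → ⟪ξ i, ξ j⟫_ℝ = 0)

/-- A strongly `ε`-separated family of points of the sphere. -/
def StronglySep (ε : ℝ) (η : Fin d → EuclideanSpace ℝ (Fin d)) : Prop :=
  Function.Injective η ∧ (∀ j, η j ∈ unitSphere d) ∧
  ∀ j : Fin d, ∀ y ∈ Submodule.span ℝ (η '' {i | i ≠ j}), ε ≤ ‖η j - y‖

/-- The reflection negating the last coordinate. -/
def lastNeg (d : ℕ) (x : EuclideanSpace ℝ (Fin d)) : EuclideanSpace ℝ (Fin d) :=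
  (EuclideanSpace.equiv (Fin d) ℝ).symm fun i => if (i : ℕ) = d - 1 then -(x i) else x i

/-- The gradient of a `d`-variate polynomial, as a vector of `ℝ^d`. -/
def polyGrad (P : MvPolynomial (Fin d) ℝ) (x : EuclideanSpace ℝ (Fin d)) :
    EuclideanSpace ℝ (Fin d) :=
  (EuclideanSpace.equiv (Fin d) ℝ).symm fun i =>
    MvPolynomial.eval (fun j => x j) (MvPolynomial.pderiv i P)

/-- The tangential gradient `∇₀P(x) = ∇P(x) − (x⬝∇P(x))·x`. -/
def tGrad (P : MvPolynomial (Fin d) ℝ) (x : EuclideanSpace ℝ (Fin d)) :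
    EuclideanSpace ℝ (Fin d) :=
  polyGrad P x - ⟪x, polyGrad P x⟫_ℝ • x

/-- The affine hyperplane through the points `ξ j`. -/
def hplane (ξ : Fin d → EuclideanSpace ℝ (Fin d)) : Set (EuclideanSpace ℝ (Fin d)) :=
  (affineSpan ℝ (Set.range ξ) : Set (EuclideanSpace ℝ (Fin d)))

/-- The ball `B(x,r)_H = {y ∈ H : ‖x − y‖ ≤ r}` in a hyperplane `H`. -/
def ballH (H : Set (EuclideanSpace ℝ (Fin d))) (x : EuclideanSpace ℝ (Fin d)) (r : ℝ) :
    Set (EuclideanSpace ℝ (Fin d)) :=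
  {y ∈ H | ‖x - y‖ ≤ r}

/-- `w(A) = ∫_A w` with respect to `(d−1)`-dimensional Hausdorff (surface) measure. -/
def hMass (w : EuclideanSpace ℝ (Fin d) → ℝ) (A : Set (EuclideanSpace ℝ (Fin d))) : ℝ :=
  ∫ x in A, w x ∂(Measure.hausdorffMeasure ((d : ℝ) - 1))

/-- The interior of `A` relative to a hyperplane `H`. -/
def hInterior (H A : Set (EuclideanSpace ℝ (Fin d))) : Set (EuclideanSpace ℝ (Fin d)) :=
  {x ∈ A | ∃ ε : ℝ, 0 < ε ∧ Metric.ball x ε ∩ H ⊆ A}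

/-- A great subsphere has surface measure zero. -/
lemma sphMeasure_ker_eq_zero (hd : 2 ≤ d) (f : EuclideanSpace ℝ (Fin d) →ₗ[ℝ] ℝ) (hf : f ≠ 0) :
    sphMeasure d {x | f x = 0} = 0 := by
  classical
  have hmeas : MeasurableSet {x | f x = 0} :=
    (isClosed_eq f.continuous_of_finiteDimensional continuous_const).measurableSet
  rw [sphMeasure, Measure.restrict_apply hmeas]
  rcases ({x | f x = 0} ∩ unitSphere d).eq_empty_or_nonempty with he | ⟨v, hfv, hvS⟩
  · simp [he]
  have hv : ‖v‖ = 1 := by simpa [unitSphere] using hvS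
  have hfv : f v = 0 := hfv
  have hvv : ⟪v, v⟫_ℝ = 1 := by rw [real_inner_self_eq_norm_sq, hv]; norm_num
  set P : Submodule ℝ (EuclideanSpace ℝ (Fin d)) := LinearMap.ker f ⊓ (ℝ ∙ v)ᗮ with hP
  have hlt1 : P < LinearMap.ker f := by
    refine lt_of_le_of_ne inf_le_left fun h => ?_
    have hvP : v ∈ P := by rw [h]; exact hfv
    have := (Submodule.mem_orthogonal_singleton_iff_inner_right.1 hvP.2)
    linarith
  have hlt2 : LinearMap.ker f < ⊤ := by
    rw [lt_top_iff_ne_top]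
    intro h
    exact hf (LinearMap.ker_eq_top.1 h)
  have h1 := Submodule.finrank_lt_finrank_of_lt hlt1
  have h2 := Submodule.finrank_lt_finrank_of_lt hlt2
  rw [finrank_top, finrank_euclideanSpace_fin] at h2
  have hsub : {x | f x = 0} ∩ unitSphere d ⊆
      {v} ∪ range (fun w : P => stereoInvFunAux v (w : EuclideanSpace ℝ (Fin d))) := by
    rintro x ⟨hfx, hxS⟩
    have hfx : f x = 0 := hfx
    have hx : ‖x‖ = 1 := by simpa [unitSphere] using hxS
    by_cases hxv : x = v
    · exact Or.inl hxv
    refine Or.inr ?_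
    have hne : ⟪v, x⟫_ℝ < 1 := by
      rw [real_inner_comm]
      exact inner_lt_one_iff_real_of_norm_eq_one hx hv |>.2 hxv
    set a := ⟪v, x⟫_ℝ with ha
    have hxx : ⟪x, x⟫_ℝ = 1 := by rw [real_inner_self_eq_norm_sq, hx]; norm_num
    have h1a : (1 - a) ≠ 0 := by linarith
    refine ⟨⟨(2 / (1 - a)) • (x - a • v), ?_, ?_⟩, ?_⟩
    · simp [hfx, hfv]
    · rw [SetLike.mem_coe, Submodule.mem_orthogonal_singleton_iff_inner_right, inner_smul_right,
        inner_sub_right, inner_smul_right, hvv, ← ha]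
      ring
    · have hn : ‖(2 / (1 - a)) • (x - a • v)‖ ^ 2 = 4 * (1 + a) / (1 - a) := by
        rw [← real_inner_self_eq_norm_sq, inner_smul_left, inner_smul_right, inner_sub_left,
          inner_sub_right, inner_sub_right, inner_smul_left, inner_smul_right, inner_smul_left,
          inner_smul_right, hvv, hxx, real_inner_comm, ← ha]
        simp only [conj_trivial]
        field_simp
        ring
      simp only [stereoInvFunAux_apply, hn]
      have e1 : 4 * (1 + a) / (1 - a) + 4 = 8 / (1 - a) := by field_simp; ring
      have e2 : 4 * (1 + a) / (1 - a) - 4 = 8 * a / (1 - a) := by field_simp; ring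
      rw [e1, e2]
      ext i
      simp only [PiLp.smul_apply, PiLp.add_apply, PiLp.sub_apply, smul_eq_mul]
      field_simp
      ring
  have hdim : dimH ({x | f x = 0} ∩ unitSphere d) < ((d - 1 : ℕ) : NNReal) := by
    refine (dimH_mono hsub).trans_lt ?_
    rw [dimH_union, dimH_singleton, max_lt_iff]
    constructor
    · have : 0 < d - 1 := by omega
      exact_mod_cast this
    · refine (ContDiff.dimH_range_le (contDiff_stereoInvFunAux.comp P.subtypeL.contDiff)).trans_lt ?_
      have : Module.finrank ℝ P < d - 1 := by omega
      exact_mod_cast this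
  have := hausdorffMeasure_of_dimH_lt hdim
  have hcast : (((d - 1 : ℕ) : NNReal) : ℝ) = (d : ℝ) - 1 := by
    rw [NNReal.coe_natCast, Nat.cast_sub (by omega)]; simp
  rwa [hcast] at this

lemma norm_sub_le_gdist {x y : EuclideanSpace ℝ (Fin d)} (hx : ‖x‖ = 1) (hy : ‖y‖ = 1) :
    ‖x - y‖ ≤ gdist x y := by
  have hab := abs_real_inner_le_norm x y
  rw [hx, hy, one_mul, abs_le] at hab
  have h := @one_sub_sq_div_two_le_cos (arccos ⟪x, y⟫_ℝ)
  rw [cos_arccos hab.1 hab.2] at h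
  have h2 := norm_sub_sq_real x y
  rw [hx, hy] at h2
  refine abs_le_of_sq_le_sq' ?_ (arccos_nonneg _) |>.2
  rw [h2]
  linarith

lemma gdist_le_two_mul_norm_sub {x y : EuclideanSpace ℝ (Fin d)} (hx : ‖x‖ = 1) (hy : ‖y‖ = 1) :
    gdist x y ≤ 2 * ‖x - y‖ := by
  have hab := abs_real_inner_le_norm x y
  rw [hx, hy, one_mul, abs_le] at hab
  have h := Real.cos_le_one_sub_mul_cos_sq (x := arccos ⟪x, y⟫_ℝ)
    (by rw [abs_of_nonneg (arccos_nonneg _)]; exact arccos_le_pi _)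
  rw [cos_arccos hab.1 hab.2] at h
  have h2 := norm_sub_sq_real x y
  rw [hx, hy] at h2
  refine abs_le_of_sq_le_sq' ?_ (by positivity) |>.2
  rw [mul_pow, h2, gdist]
  have hpi : π ^ 2 ≤ 16 := by nlinarith [pi_pos, pi_le_four]
  have h3 : 1 / 8 ≤ 2 / π ^ 2 := by
    rw [div_le_div_iff₀ (by norm_num) (by positivity)]; linarith
  nlinarith [mul_le_mul_of_nonneg_right h3 (sq_nonneg (arccos ⟪x, y⟫_ℝ))]

lemma isClosed_unitSphere : IsClosed (unitSphere d) := Metric.isClosed_sphere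

lemma wMass_inter_unitSphere (w : EuclideanSpace ℝ (Fin d) → ℝ)
    (A : Set (EuclideanSpace ℝ (Fin d))) : wMass w (A ∩ unitSphere d) = wMass w A := by
  rw [wMass, wMass, sphMeasure, Measure.restrict_restrict' isClosed_unitSphere.measurableSet,
    Measure.restrict_restrict' isClosed_unitSphere.measurableSet, inter_assoc, inter_self]

lemma wMass_mono {w : EuclideanSpace ℝ (Fin d) → ℝ} (hw : ∀ x, 0 ≤ w x)
    (hwi : Integrable w (sphMeasure d)) {A B : Set (EuclideanSpace ℝ (Fin d))} (h : A ⊆ B) :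
    wMass w A ≤ wMass w B :=
  setIntegral_mono_set hwi.integrableOn (ae_of_all _ hw) h.eventuallyLE

lemma wMass_union {w : EuclideanSpace ℝ (Fin d) → ℝ} (hwi : Integrable w (sphMeasure d))
    {A B : Set (EuclideanSpace ℝ (Fin d))} (hB : IsClosed B) (h : sphMeasure d (A ∩ B) = 0) :
    wMass w (A ∪ B) = wMass w A + wMass w B :=
  setIntegral_union₀ h hB.measurableSet.nullMeasurableSet hwi.integrableOn hwi.integrableOn

/-- Sections of a closed set by a pencil of half-spaces have continuously varying mass. -/
lemma continuous_wMass_inter_halfspace (hd : 2 ≤ d) {w : EuclideanSpace ℝ (Fin d) → ℝ}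
    (hwi : Integrable w (sphMeasure d)) {K : Set (EuclideanSpace ℝ (Fin d))} (hK : IsClosed K)
    (f g : EuclideanSpace ℝ (Fin d) →ₗ[ℝ] ℝ) (hfg : ∀ p : ℝ, f - p • g ≠ 0) :
    Continuous fun p : ℝ => wMass w (K ∩ {x | f x ≤ p * g x}) := by
  have hf := f.continuous_of_finiteDimensional
  have hg := g.continuous_of_finiteDimensional
  have hcl (p : ℝ) : MeasurableSet (K ∩ {x | f x ≤ p * g x}) :=
    (hK.inter (isClosed_le hf (by fun_prop))).measurableSet
  rw [continuous_iff_continuousAt]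
  intro p₀
  simp only [wMass, ← integral_indicator (hcl _)]
  refine continuousAt_of_dominated (bound := fun x => ‖w x‖) ?_ ?_ hwi.norm ?_
  · exact Filter.Eventually.of_forall fun p => (hwi.indicator (hcl p)).aestronglyMeasurable
  · exact Filter.Eventually.of_forall fun p => ae_of_all _ fun x => norm_indicator_le_norm_self _ _
  · have h0 := sphMeasure_ker_eq_zero hd _ (hfg p₀)
    have h1 : ∀ᵐ x ∂(sphMeasure d), f x ≠ p₀ * g x := by
      rw [ae_iff]
      convert h0 using 3 with x
      simp [sub_eq_zero]
    filter_upwards [h1] with x hx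
    rcases lt_or_gt_of_ne hx with h | h
    · have hev : ∀ᶠ p in nhds p₀, f x < p * g x :=
        (by fun_prop : Continuous fun p : ℝ => p * g x).continuousAt.eventually_const_lt h
      refine ContinuousAt.congr (f := fun _ => K.indicator w x) continuousAt_const ?_
      filter_upwards [hev] with p hp
      by_cases hxK : x ∈ K
      · rw [indicator_of_mem hxK,
          indicator_of_mem (show x ∈ K ∩ {x | f x ≤ p * g x} from ⟨hxK, hp.le⟩)]
      · rw [indicator_of_notMem hxK, indicator_of_notMem fun h => hxK h.1]
    · have hev : ∀ᶠ p in nhds p₀, p * g x < f x :=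
        (by fun_prop : Continuous fun p : ℝ => p * g x).continuousAt.eventually_lt_const h
      refine ContinuousAt.congr (f := fun _ => (0 : ℝ)) continuousAt_const ?_
      filter_upwards [hev] with p hp
      rw [indicator_of_notMem fun h => (not_le.2 hp) h.2]

lemma sphMeasure_pencil_eq_zero (hd : 2 ≤ d) (f g : EuclideanSpace ℝ (Fin d) →ₗ[ℝ] ℝ) (p : ℝ)
    (hfg : f - p • g ≠ 0) {A : Set (EuclideanSpace ℝ (Fin d))} (hA : ∀ x ∈ A, f x = p * g x) :
    sphMeasure d A = 0 :=
  measure_mono_null (t := {x | (f - p • g) x = 0}) (fun x hx => by simp [hA x hx])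
    (sphMeasure_ker_eq_zero hd _ hfg)

/-- If a pencil of half-spaces gains mass at least `1 / N` over a parameter interval, some
intermediate half-space cuts off an integral multiple of `1 / N`. -/
lemma exists_integral_cut (hd : 2 ≤ d) {w : EuclideanSpace ℝ (Fin d) → ℝ}
    (hw : ∀ x, 0 ≤ w x) (hwi : Integrable w (sphMeasure d)) {N : ℕ} (hN : 0 < N)
    {K : Set (EuclideanSpace ℝ (Fin d))} (hK : IsClosed K)
    (f g : EuclideanSpace ℝ (Fin d) →ₗ[ℝ] ℝ) (hfg : ∀ p : ℝ, f - p • g ≠ 0)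
    {p₁ p₂ : ℝ} (hp : p₁ ≤ p₂)
    (hmass : 1 / (N : ℝ) ≤ wMass w (K ∩ {x | p₁ * g x ≤ f x ∧ f x ≤ p₂ * g x}))
    (hg : ∀ x ∈ K, 0 ≤ g x) :
    ∃ p ∈ Icc p₁ p₂, ∃ k : ℤ, (N : ℝ) * wMass w (K ∩ {x | f x ≤ p * g x}) = k := by
  have hN' : (0 : ℝ) < N := by exact_mod_cast hN
  set m : ℝ → ℝ := fun p => (N : ℝ) * wMass w (K ∩ {x | f x ≤ p * g x}) with hm
  have hcont : Continuous m :=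
    continuous_const.mul (continuous_wMass_inter_halfspace hd hwi hK f g hfg)
  have hf := f.continuous_of_finiteDimensional
  have hg' := g.continuous_of_finiteDimensional
  have hadd : m p₁ + 1 ≤ m p₂ := by
    have h1 : wMass w (K ∩ {x | f x ≤ p₁ * g x}) +
        wMass w (K ∩ {x | p₁ * g x ≤ f x ∧ f x ≤ p₂ * g x}) ≤
        wMass w (K ∩ {x | f x ≤ p₂ * g x}) := by
      rw [← wMass_union hwi]
      · refine wMass_mono hw hwi ?_
        rintro x (⟨hxK, hx⟩ | ⟨hxK, hx⟩)
        · exact ⟨hxK, le_trans hx (mul_le_mul_of_nonneg_right hp (hg x hxK))⟩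
        · exact ⟨hxK, hx.2⟩
      · exact hK.inter ((isClosed_le (by fun_prop) hf).inter (isClosed_le hf (by fun_prop)))
      · exact sphMeasure_pencil_eq_zero hd f g p₁ (hfg p₁)
          fun x hx => le_antisymm hx.1.2 hx.2.2.1
    have h2 : (N : ℝ) * (1 / N) = 1 := by field_simp
    simp only [hm]
    nlinarith [mul_le_mul_of_nonneg_left (add_le_add_left hmass
      (wMass w (K ∩ {x | f x ≤ p₁ * g x}))) hN'.le]
  obtain ⟨p, hp, hpk⟩ := intermediate_value_Icc hp hcont.continuousOn
    (show ((⌈m p₁⌉ : ℤ) : ℝ) ∈ Icc (m p₁) (m p₂) from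
      ⟨Int.le_ceil _, (Int.ceil_lt_add_one _).le.trans hadd⟩)
  exact ⟨p, hp, _, hpk⟩

/-- A system of `n + 1` linear coordinates on `ℝ^d` with distortion at most `C`. -/
structure Frame (n : ℕ) (C : ℝ) (s : ℕ → EuclideanSpace ℝ (Fin d) →ₗ[ℝ] ℝ) : Prop where
  bound : ∀ k ≤ n, ∀ x, |s k x| ≤ C * ‖x‖
  norm_le : ∀ x B, (∀ k ≤ n, |s k x| ≤ B) → ‖x‖ ≤ C * B
  exists_eq : ∀ v : ℕ → ℝ, ∃ x, ∀ k ≤ n, s k x = v k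

/-- The product `b k * b (k+1) * ⋯ * b (n-1)`. -/
def height (n : ℕ) (b : ℕ → ℝ) (k : ℕ) : ℝ := ∏ j ∈ Finset.Ico k n, b j

/-- The polyhedral cone on which the ratio of the `k`-th to the `(k+1)`-st coordinate lies in
`[a k, b k]`. -/
def cell (n : ℕ) (s : ℕ → EuclideanSpace ℝ (Fin d) →ₗ[ℝ] ℝ) (a b : ℕ → ℝ) :
    Set (EuclideanSpace ℝ (Fin d)) :=
  {x | ∀ k < n, a k * s (k + 1) x ≤ s k x ∧ s k x ≤ b k * s (k + 1) x}

/-- The ratio intervals `[a k, b k] ⊆ [0, 1]` are wide at scale `δ`. -/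
def Wide (n : ℕ) (δ : ℝ) (a b : ℕ → ℝ) : Prop :=
  ∀ k < n, 0 ≤ a k ∧ b k ≤ 1 ∧ δ ≤ (b k - a k) * height n b (k + 1)

lemma height_self (n : ℕ) (b : ℕ → ℝ) : height n b n = 1 := by simp [height]

lemma height_eq_mul {n k : ℕ} (b : ℕ → ℝ) (hk : k < n) :
    height n b k = b k * height n b (k + 1) :=
  Finset.prod_eq_prod_Ico_succ_bot hk b

lemma height_congr {n k : ℕ} {b b' : ℕ → ℝ} (h : ∀ j, k ≤ j → j < n → b j = b' j) :
    height n b k = height n b' k :=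
  Finset.prod_congr rfl fun j hj => h j (Finset.mem_Ico.1 hj).1 (Finset.mem_Ico.1 hj).2

lemma height_eq_of_eq_one {n j k : ℕ} {b : ℕ → ℝ} (hjk : j ≤ k) (hkn : k ≤ n)
    (h : ∀ i < k, b i = 1) : height n b j = height n b k := by
  rw [height, ← Finset.prod_Ico_consecutive b hjk hkn,
    Finset.prod_eq_one fun i hi => h i (Finset.mem_Ico.1 hi).2, one_mul, height]

lemma Wide.height_pos {n : ℕ} {δ : ℝ} {a b : ℕ → ℝ} (h : Wide n δ a b) (hδ : 0 < δ) {k : ℕ}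
    (hk : k ≤ n) : 0 < height n b k := by
  induction hk using Nat.decreasingInduction with
  | self => simp [height_self]
  | of_succ k hk ih =>
    rw [height_eq_mul b hk]
    obtain ⟨h1, h2, h3⟩ := h k hk
    have : 0 < b k - a k := pos_of_mul_pos_left (hδ.trans_le h3) ih.le
    exact mul_pos (by linarith) ih

lemma Wide.lt {n : ℕ} {δ : ℝ} {a b : ℕ → ℝ} (h : Wide n δ a b) (hδ : 0 < δ) {k : ℕ}
    (hk : k < n) : a k < b k := by
  obtain ⟨h1, h2, h3⟩ := h k hk
  exact sub_pos.1 (pos_of_mul_pos_left (hδ.trans_le h3) (h.height_pos hδ hk).le)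

/-- The coordinates of a central point of a cell. -/
def midHeight (n : ℕ) (a b : ℕ → ℝ) (k : ℕ) : ℝ := height n (fun j => (a j + b j) / 2) k

lemma Wide.midHeight_pos {n : ℕ} {δ : ℝ} {a b : ℕ → ℝ} (h : Wide n δ a b) (hδ : 0 < δ) (k : ℕ) :
    0 < midHeight n a b k := by
  rw [midHeight, height]
  refine Finset.prod_pos fun j hj => ?_
  have hj := (Finset.mem_Ico.1 hj).2
  have := h.lt hδ hj
  have := (h j hj).1
  linarith

lemma Wide.midHeight_le_one {n : ℕ} {δ : ℝ} {a b : ℕ → ℝ} (h : Wide n δ a b) (hδ : 0 < δ)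
    (k : ℕ) : midHeight n a b k ≤ 1 := by
  rw [midHeight, height]
  refine Finset.prod_le_one (fun j hj => ?_) fun j hj => ?_ <;>
  · have hj := (Finset.mem_Ico.1 hj).2
    have := h.lt hδ hj
    obtain ⟨h1, h2, -⟩ := h j hj
    linarith

lemma Wide.height_le {n : ℕ} {δ : ℝ} {a b : ℕ → ℝ} (h : Wide n δ a b) (hδ : 0 < δ) (k : ℕ) :
    height n b k ≤ 2 ^ n * midHeight n a b k := by
  have h1 : height n b k ≤ ∏ j ∈ Finset.Ico k n, (2 * ((a j + b j) / 2)) := by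
    refine Finset.prod_le_prod (fun j hj => ?_) fun j hj => ?_ <;>
    · have hj := (Finset.mem_Ico.1 hj).2
      have := h.lt hδ hj
      obtain ⟨h1, h2, -⟩ := h j hj
      linarith
  rw [Finset.prod_mul_distrib, Finset.prod_const, Nat.card_Ico] at h1
  refine h1.trans (mul_le_mul_of_nonneg_right ?_ (h.midHeight_pos hδ k).le)
  exact pow_le_pow_right₀ (by norm_num) (Nat.sub_le _ _)

lemma Wide.mid_bounds {n : ℕ} {δ : ℝ} {a b : ℕ → ℝ} (h : Wide n δ a b) (hδ : 0 < δ) {k : ℕ}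
    (hk : k < n) : a k * midHeight n a b (k + 1) ≤ midHeight n a b k ∧
      midHeight n a b k ≤ b k * midHeight n a b (k + 1) := by
  have e : midHeight n a b k = (a k + b k) / 2 * midHeight n a b (k + 1) := height_eq_mul _ hk
  have := h.midHeight_pos hδ (k + 1)
  have := h.lt hδ hk
  rw [e]
  constructor <;> nlinarith

lemma isClosed_cell (n : ℕ) (s : ℕ → EuclideanSpace ℝ (Fin d) →ₗ[ℝ] ℝ) (a b : ℕ → ℝ) :
    IsClosed (cell n s a b) := by
  have hs (k : ℕ) : Continuous (s k) := (s k).continuous_of_finiteDimensional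
  simp only [cell, ofPred_forall]
  refine isClosed_iInter fun k => isClosed_iInter fun _ => ?_
  exact (isClosed_le (by fun_prop) (hs k)).inter (isClosed_le (hs k) (by fun_prop))

lemma combination_mem_cell {n : ℕ} {s : ℕ → EuclideanSpace ℝ (Fin d) →ₗ[ℝ] ℝ} {a b : ℕ → ℝ}
    {x y : EuclideanSpace ℝ (Fin d)} (hx : x ∈ cell n s a b) (hy : y ∈ cell n s a b)
    {t₁ t₂ : ℝ} (h₁ : 0 ≤ t₁) (h₂ : 0 ≤ t₂) : t₁ • x + t₂ • y ∈ cell n s a b := by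
  intro k hk
  obtain ⟨hx1, hx2⟩ := hx k hk
  obtain ⟨hy1, hy2⟩ := hy k hk
  simp only [map_add, map_smul, smul_eq_mul]
  constructor <;> nlinarith [mul_le_mul_of_nonneg_left hx1 h₁, mul_le_mul_of_nonneg_left hx2 h₁,
    mul_le_mul_of_nonneg_left hy1 h₂, mul_le_mul_of_nonneg_left hy2 h₂]

lemma smul_mem_cell {n : ℕ} {s : ℕ → EuclideanSpace ℝ (Fin d) →ₗ[ℝ] ℝ} {a b : ℕ → ℝ}
    {x : EuclideanSpace ℝ (Fin d)} (hx : x ∈ cell n s a b) {t : ℝ} (h : 0 ≤ t) :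
    t • x ∈ cell n s a b := by
  simpa using combination_mem_cell hx hx h le_rfl

lemma Frame.mem_cell_of_norm_sub_le {n : ℕ} {C : ℝ} {s : ℕ → EuclideanSpace ℝ (Fin d) →ₗ[ℝ] ℝ}
    (hs : Frame n C s) {δ : ℝ} {a b : ℕ → ℝ} (h : Wide n δ a b) (hδ : 0 < δ)
    {x y : EuclideanSpace ℝ (Fin d)} (hy : ∀ k ≤ n, s k y = midHeight n a b k)
    (hxy : C * ‖x - y‖ ≤ δ / 2 ^ (n + 2)) : x ∈ cell n s a b := by
  intro k hk
  set ε := δ / 2 ^ (n + 2) with hε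
  have hclose (j : ℕ) (hj : j ≤ n) : |s j x - midHeight n a b j| ≤ ε := by
    rw [← hy j hj, ← map_sub]
    exact (hs.bound j hj _).trans hxy
  have h0 := abs_le.1 (hclose k hk.le)
  have h1 := abs_le.1 (hclose (k + 1) hk)
  have e : midHeight n a b k = (a k + b k) / 2 * midHeight n a b (k + 1) := height_eq_mul _ hk
  obtain ⟨ha, hb, hab⟩ := h k hk
  have hlt := h.lt hδ hk
  have hge : 4 * ε ≤ (b k - a k) * midHeight n a b (k + 1) := by
    have h2 := hab.trans (mul_le_mul_of_nonneg_left (h.height_le hδ (k + 1)) (sub_pos.2 hlt).le)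
    have h3 : 4 * ε * 2 ^ n = δ := by rw [hε, pow_add]; field_simp; norm_num
    have h4 : (0 : ℝ) < 2 ^ n := by positivity
    refine le_of_mul_le_mul_right ?_ h4
    linarith
  have hεp : 0 < ε := by positivity
  rw [e] at h0
  constructor <;> nlinarith

lemma Frame.pos {n : ℕ} {C : ℝ} {s : ℕ → EuclideanSpace ℝ (Fin d) →ₗ[ℝ] ℝ}
    (hs : Frame n C s) : 0 < C := by
  obtain ⟨x, hx⟩ := hs.exists_eq fun _ => 1
  have h1 := hs.bound n le_rfl x
  rw [hx n le_rfl, abs_one] at h1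
  exact pos_of_mul_pos_left (one_pos.trans_le h1) (norm_nonneg x)

/-- Every wide cell contains a cap of comparable radius; if its ratio intervals are moreover
short, the cell is contained in a cap of comparable radius. -/
lemma Frame.exists_cap_subset_cell {n : ℕ} (hn : 1 ≤ n) {C : ℝ}
    {s : ℕ → EuclideanSpace ℝ (Fin d) →ₗ[ℝ] ℝ} (hs : Frame n C s) {δ ρ : ℝ} {a b : ℕ → ℝ}
    (h : Wide n δ a b) (hδ : 0 < δ) (hρ : 2 ^ (n + 2) * C ^ 2 * ρ ≤ δ) :
    ∃ c ∈ unitSphere d, cap c ρ ⊆ cell n s a b ∧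
      ((∀ k < n, (b k - a k) * height n b (k + 1) ≤ 4 * δ) →
        cell n s a b ∩ unitSphere d ⊆ cap c (16 * n * C ^ 2 * δ)) := by
  obtain ⟨y, hy⟩ := hs.exists_eq (midHeight n a b)
  have hC := hs.pos
  have hyn : s n y = 1 := by rw [hy n le_rfl, midHeight, height_self]
  have hy0 : y ≠ 0 := by rintro rfl; simp at hyn
  have hyp : 0 < ‖y‖ := norm_pos_iff.2 hy0
  have hyC : ‖y‖ ≤ C := by
    have := hs.norm_le y 1 fun k hk => by
      rw [hy k hk, abs_of_pos (h.midHeight_pos hδ k)]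
      exact h.midHeight_le_one hδ k
    linarith
  have hc1 : ‖‖y‖⁻¹ • y‖ = 1 := by
    rw [norm_smul, norm_inv, norm_norm, inv_mul_cancel₀ hyp.ne']
  refine ⟨‖y‖⁻¹ • y, by simpa [unitSphere] using hc1, ?_, ?_⟩
  · rintro z ⟨hz, hzc⟩
    have hz1 : ‖z‖ = 1 := by simpa [unitSphere] using hz
    have hd := (norm_sub_le_gdist hc1 hz1).trans hzc
    have hmem : ‖y‖ • z ∈ cell n s a b := by
      refine hs.mem_cell_of_norm_sub_le h hδ hy ?_
      have e : ‖y‖ • z - y = ‖y‖ • (z - ‖y‖⁻¹ • y) := by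
        rw [smul_sub, smul_smul, mul_inv_cancel₀ hyp.ne', one_smul]
      rw [e, norm_smul, norm_norm, norm_sub_rev, le_div_iff₀ (by positivity)]
      have h1 : ‖y‖ * ‖‖y‖⁻¹ • y - z‖ ≤ C * ρ :=
        mul_le_mul hyC hd (norm_nonneg _) hC.le
      have h2 : (0 : ℝ) ≤ C * 2 ^ (n + 2) := by positivity
      nlinarith [mul_le_mul_of_nonneg_left h1 h2]
    have := smul_mem_cell hmem (inv_nonneg.2 hyp.le)
    rwa [smul_smul, inv_mul_cancel₀ hyp.ne', one_smul] at this
  · rintro hshort z ⟨hzK, hz⟩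
    have hz1 : ‖z‖ = 1 := by simpa [unitSphere] using hz
    have hnn (k : ℕ) (hk : k ≤ n) : 0 ≤ s k z := by
      have hsucc (j : ℕ) (hj : j < n) : 0 ≤ s (j + 1) z := by
        obtain ⟨h1, h2⟩ := hzK j hj
        have := h.lt hδ hj
        by_contra hneg
        nlinarith
      rcases k with _ | k
      · exact (mul_nonneg (h 0 hn).1 (hsucc 0 hn)).trans (hzK 0 hn).1
      · exact hsucc k hk
    have hmono (k : ℕ) (hk : k ≤ n) : s k z ≤ s n z := by
      induction hk using Nat.decreasingInduction with
      | self => exact le_rfl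
      | of_succ k hk ih =>
        refine ((hzK k hk).2.trans ?_).trans ih
        nlinarith [hnn (k + 1) hk, (h k hk).2.1]
    have hzn : 1 ≤ C * s n z := by
      rw [← hz1]
      exact hs.norm_le z _ fun k hk => by rw [abs_of_nonneg (hnn k hk)]; exact hmono k hk
    set l := s n z with hl
    have hlpos : 0 < l := pos_of_mul_pos_right (one_pos.trans_le hzn) hC.le
    have hlC : l ≤ C := by
      have := hs.bound n le_rfl z
      rw [hz1, mul_one] at this
      exact (le_abs_self _).trans this
    set x := l⁻¹ • z with hx
    have hxK : x ∈ cell n s a b := smul_mem_cell hzK (inv_nonneg.2 hlpos.le)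
    have hxn : s n x = 1 := by
      rw [hx, map_smul, smul_eq_mul, ← hl, inv_mul_cancel₀ hlpos.ne']
    have hzx : z = l • x := by rw [hx, smul_smul, mul_inv_cancel₀ hlpos.ne', one_smul]
    have hxnn (k : ℕ) (hk : k ≤ n) : 0 ≤ s k x := by
      rw [hx, map_smul]; exact mul_nonneg (inv_nonneg.2 hlpos.le) (hnn k hk)
    have key (u v : ℕ → ℝ) (hun : u n = 1) (hvn : v n = 1) (hu0 : ∀ k ≤ n, 0 ≤ u k)
        (hu : ∀ k < n, a k * u (k + 1) ≤ u k ∧ u k ≤ b k * u (k + 1))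
        (hv : ∀ k < n, a k * v (k + 1) ≤ v k ∧ v k ≤ b k * v (k + 1)) (k : ℕ) (hk : k ≤ n) :
        u k - v k ≤ 4 * δ * (n - k : ℝ) := by
      have huh (k : ℕ) (hk : k ≤ n) : u k ≤ height n b k := by
        induction hk using Nat.decreasingInduction with
        | self => rw [hun, height_self]
        | of_succ k hk ih =>
          rw [height_eq_mul b hk]
          refine (hu k hk).2.trans (mul_le_mul_of_nonneg_left ih ?_)
          exact (h k hk).1.trans (h.lt hδ hk).le
      induction hk using Nat.decreasingInduction with
      | self => simp [hun, hvn]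
      | of_succ k hk ih =>
        obtain ⟨ha, hb, -⟩ := h k hk
        have hlt := h.lt hδ hk
        have h1 : (b k - a k) * u (k + 1) ≤ 4 * δ :=
          (mul_le_mul_of_nonneg_left (huh (k + 1) hk) (sub_pos.2 hlt).le).trans (hshort k hk)
        have h2 : a k * (u (k + 1) - v (k + 1)) ≤ 4 * δ * (n - (k + 1) : ℝ) := by
          push_cast at ih
          have h3 : (0 : ℝ) ≤ 4 * δ * (n - (k + 1) : ℝ) := by
            have : ((k + 1 : ℕ) : ℝ) ≤ n := by exact_mod_cast hk
            push_cast at this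
            exact mul_nonneg (by linarith) (by linarith)
          nlinarith
        nlinarith [(hu k hk).2, (hv k hk).1]
    have hxy : ‖x - y‖ ≤ C * (4 * δ * n) := by
      refine hs.norm_le _ _ fun k hk => ?_
      rw [map_sub, hy k hk]
      have hk0 : 4 * δ * (n - k : ℝ) ≤ 4 * δ * n := by
        have : (0 : ℝ) ≤ k := by positivity
        nlinarith
      have hm : midHeight n a b n = 1 := height_self _ _
      have hmb := fun k (hk : k < n) => h.mid_bounds hδ hk
      refine abs_le.2 ⟨?_, ?_⟩
      · have := key (midHeight n a b) (fun k => s k x) hm hxn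
          (fun k _ => (h.midHeight_pos hδ k).le) hmb hxK k hk
        linarith
      · exact (key (fun k => s k x) (midHeight n a b) hxn hm hxnn hxK hmb k hk).trans hk0
    have hlx : l * ‖x‖ = 1 := by
      have e : ‖l • x‖ = 1 := by rw [← hzx, hz1]
      rwa [norm_smul l x, Real.norm_of_nonneg hlpos.le] at e
    have hchord : ‖‖y‖⁻¹ • y - z‖ ≤ 2 * (l * ‖x - y‖) := by
      have e : z - ‖y‖⁻¹ • y = l • (x - y) + (l * (‖y‖ - ‖x‖)) • (‖y‖⁻¹ • y) := by
        have e1 : (l * ‖y‖) • ‖y‖⁻¹ • y = l • y := by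
          rw [smul_smul, mul_assoc, mul_inv_cancel₀ hyp.ne', mul_one]
        rw [mul_sub, hlx, sub_smul, one_smul, e1, smul_sub, ← hzx]
        abel
      rw [norm_sub_rev, e]
      refine (norm_add_le _ _).trans ?_
      rw [norm_smul, norm_smul, hc1, mul_one, norm_mul, Real.norm_of_nonneg hlpos.le,
        Real.norm_eq_abs]
      have := abs_norm_sub_norm_le y x
      rw [norm_sub_rev] at this
      nlinarith [mul_le_mul_of_nonneg_left this hlpos.le]
    refine ⟨hz, (gdist_le_two_mul_norm_sub hc1 hz1).trans ?_⟩
    have h1 : l * ‖x - y‖ ≤ C * (C * (4 * δ * n)) := mul_le_mul hlC hxy (norm_nonneg _) hC.le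
    nlinarith

/-- Integrable nonnegative weights giving mass at least `1 / N` to every cap of radius `r`. -/
structure CapWeight (w : EuclideanSpace ℝ (Fin d) → ℝ) (r : ℝ) (N : ℕ) : Prop where
  nonneg : ∀ x, 0 ≤ w x
  integrable : Integrable w (sphMeasure d)
  pos : 0 < N
  mass : ∀ x ∈ unitSphere d, 1 / (N : ℝ) ≤ wMass w (cap x r)

/-- A set whose mass is an integral multiple of `1 / N`. -/
def IntegralMass (w : EuclideanSpace ℝ (Fin d) → ℝ) (N : ℕ)
    (K : Set (EuclideanSpace ℝ (Fin d))) : Prop :=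
  ∃ k : ℤ, (N : ℝ) * wMass w K = k

/-- A closed convex cone of integral mass whose trace on the sphere lies between two concentric
caps of radii `r` and `D * r`. -/
structure IsTile (w : EuclideanSpace ℝ (Fin d) → ℝ) (r : ℝ) (N : ℕ) (D : ℝ)
    (K : Set (EuclideanSpace ℝ (Fin d))) : Prop where
  isClosed : IsClosed K
  combination_mem : ∀ x ∈ K, ∀ y ∈ K, ∀ t₁ t₂ : ℝ, 0 ≤ t₁ → 0 ≤ t₂ → t₁ • x + t₂ • y ∈ K
  exists_cap : ∃ c ∈ unitSphere d, cap c r ⊆ K ∧ K ∩ unitSphere d ⊆ cap c (D * r)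
  integralMass : IntegralMass w N K

/-- A set that is a finite union of almost disjoint tiles. -/
def Tileable (w : EuclideanSpace ℝ (Fin d) → ℝ) (r : ℝ) (N : ℕ) (D : ℝ)
    (K : Set (EuclideanSpace ℝ (Fin d))) : Prop :=
  ∃ F : Set (Set (EuclideanSpace ℝ (Fin d))), F.Finite ∧ ⋃₀ F = K ∧
    F.Pairwise (fun A B => sphMeasure d (A ∩ B) = 0) ∧ ∀ A ∈ F, IsTile w r N D A

section Tiling

variable {w : EuclideanSpace ℝ (Fin d) → ℝ} {r : ℝ} {N : ℕ} {D : ℝ}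
  {K K₁ K₂ : Set (EuclideanSpace ℝ (Fin d))}

lemma IsTile.tileable (h : IsTile w r N D K) : Tileable w r N D K :=
  ⟨{K}, finite_singleton K, sUnion_singleton K, pairwise_singleton _ _, by simpa using h⟩

lemma Tileable.union (h₁ : Tileable w r N D K₁) (h₂ : Tileable w r N D K₂)
    (h : sphMeasure d (K₁ ∩ K₂) = 0) : Tileable w r N D (K₁ ∪ K₂) := by
  obtain ⟨F, hF, rfl, hFd, hFt⟩ := h₁
  obtain ⟨G, hG, rfl, hGd, hGt⟩ := h₂
  refine ⟨F ∪ G, hF.union hG, sUnion_union F G, ?_, ?_⟩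
  · have hFG (A) (hA : A ∈ F) (B) (hB : B ∈ G) : sphMeasure d (A ∩ B) = 0 :=
      measure_mono_null (inter_subset_inter (subset_sUnion_of_mem hA) (subset_sUnion_of_mem hB)) h
    rintro A (hA | hA) B (hB | hB) hne
    · exact hFd hA hB hne
    · exact hFG A hA B hB
    · rw [inter_comm]; exact hFG B hB A hA
    · exact hGd hA hB hne
  · rintro A (hA | hA)
    · exact hFt A hA
    · exact hGt A hA

lemma IntegralMass.of_union (hwi : Integrable w (sphMeasure d)) (hK₂ : IsClosed K₂)
    (h : sphMeasure d (K₁ ∩ K₂) = 0) (hU : IntegralMass w N (K₁ ∪ K₂))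
    (h₁ : IntegralMass w N K₁) : IntegralMass w N K₂ := by
  obtain ⟨k, hk⟩ := hU
  obtain ⟨l, hl⟩ := h₁
  refine ⟨k - l, ?_⟩
  rw [wMass_union hwi hK₂ h] at hk
  push_cast
  linarith

lemma Frame.sub_smul_ne_zero {n : ℕ} {C : ℝ} {s : ℕ → EuclideanSpace ℝ (Fin d) →ₗ[ℝ] ℝ}
    (hs : Frame n C s) {i j : ℕ} (hi : i ≤ n) (hj : j ≤ n) (hij : i ≠ j) (p : ℝ) :
    s i - p • s j ≠ 0 := by
  intro h
  obtain ⟨x, hx⟩ := hs.exists_eq (Pi.single i 1)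
  have := LinearMap.congr_fun h x
  simp [hx i hi, hx j hj, hij.symm] at this

lemma Wide.nonneg_of_mem_cell {n : ℕ} {s : ℕ → EuclideanSpace ℝ (Fin d) →ₗ[ℝ] ℝ} {a b : ℕ → ℝ}
    {k : ℕ} (hk : k < n) (hab : a k < b k) {x : EuclideanSpace ℝ (Fin d)}
    (hx : x ∈ cell n s a b) : 0 ≤ s (k + 1) x := by
  obtain ⟨h1, h2⟩ := hx k hk
  by_contra hneg
  nlinarith

/-- Narrowing one uncut ratio interval keeps a cell wide. -/
lemma Wide.update {n k : ℕ} {δ : ℝ} {a b : ℕ → ℝ} (h : Wide n δ a b) (hδ : 0 < δ) (hk : k < n)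
    (htriv : ∀ j < k + 1, a j = 0 ∧ b j = 1) {p q : ℝ} (hp : 0 ≤ p) (hq : q ≤ 1)
    (hpq : δ ≤ (q - p) * height n b (k + 1)) :
    Wide n δ (Function.update a k p) (Function.update b k q) := by
  have hup (j : ℕ) (hj : k < j) : height n (Function.update b k q) j = height n b j :=
    height_congr fun i hi _ => Function.update_of_ne (by omega) _ _
  have hh := h.height_pos hδ (Nat.succ_le_of_lt hk)
  intro j hj
  rcases lt_trichotomy j k with hjk | rfl | hjk
  · rw [Function.update_of_ne hjk.ne, Function.update_of_ne hjk.ne, (htriv j (by omega)).1,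
      (htriv j (by omega)).2]
    refine ⟨le_rfl, le_rfl, ?_⟩
    rw [height_eq_of_eq_one (b := Function.update b k q) (Nat.succ_le_of_lt hjk) hk.le
      fun i hi => by rw [Function.update_of_ne hi.ne, (htriv i (by omega)).2],
      height_eq_mul _ hk, Function.update_self, hup _ (by omega)]
    nlinarith
  · simp only [Function.update_self]
    rw [hup _ (by omega)]
    exact ⟨hp, hq, hpq⟩
  · rw [Function.update_of_ne hjk.ne', Function.update_of_ne hjk.ne', hup _ (by omega)]
    exact h j hj

lemma mem_cell_update {n k : ℕ} {s : ℕ → EuclideanSpace ℝ (Fin d) →ₗ[ℝ] ℝ} {a b : ℕ → ℝ}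
    {p q : ℝ} (hk : k < n) {x : EuclideanSpace ℝ (Fin d)} :
    x ∈ cell n s (Function.update a k p) (Function.update b k q) ↔
      (∀ j < n, j ≠ k → a j * s (j + 1) x ≤ s j x ∧ s j x ≤ b j * s (j + 1) x) ∧
        p * s (k + 1) x ≤ s k x ∧ s k x ≤ q * s (k + 1) x := by
  constructor
  · intro h
    refine ⟨fun j hj hjk => ?_, ?_⟩
    · simpa [Function.update_of_ne hjk] using h j hj
    · simpa using h k hk
  · rintro ⟨h1, h2⟩ j hj
    by_cases hjk : j = k
    · subst hjk; simpa using h2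
    · simpa [Function.update_of_ne hjk] using h1 j hj hjk

/-- A wide cell of integral mass whose last ratio intervals are short is tileable. -/
theorem Wide.tileable (hd : 2 ≤ d) (hw : CapWeight w r N) {n : ℕ} (hn : 1 ≤ n) {C : ℝ}
    {s : ℕ → EuclideanSpace ℝ (Fin d) →ₗ[ℝ] ℝ} (hs : Frame n C s) {δ : ℝ} (hδ : 0 < δ)
    (hr : 2 ^ (n + 2) * C ^ 2 * r ≤ δ) (hD : 16 * n * C ^ 2 * δ ≤ D * r) (k : ℕ) (hk : k ≤ n)
    (a b : ℕ → ℝ) (h : Wide n δ a b) (htriv : ∀ j < k, a j = 0 ∧ b j = 1)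
    (hshort : ∀ j, k ≤ j → j < n → (b j - a j) * height n b (j + 1) ≤ 4 * δ)
    (hint : IntegralMass w N (cell n s a b)) : Tileable w r N D (cell n s a b) := by
  induction k generalizing a b with
  | zero =>
    obtain ⟨c, hc, hc1, hc2⟩ := hs.exists_cap_subset_cell hn h hδ hr
    refine IsTile.tileable ⟨isClosed_cell n s a b,
      fun x hx y hy t₁ t₂ h1 h2 => combination_mem_cell hx hy h1 h2, ⟨c, hc, hc1, ?_⟩, hint⟩
    refine (hc2 fun j hj => hshort j (Nat.zero_le j) hj).trans fun x hx => ?_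
    exact ⟨hx.1, hx.2.trans hD⟩
  | succ k ih =>
    have hkn : k < n := hk
    set H := height n b (k + 1) with hH
    have hHpos : 0 < H := h.height_pos hδ hk
    set σ := δ / H with hσ
    have hσpos : 0 < σ := div_pos hδ hHpos
    have hσH : σ * H = δ := div_mul_cancel₀ _ hHpos.ne'
    set L : ℝ → ℝ → Set (EuclideanSpace ℝ (Fin d)) := fun p q =>
      cell n s (Function.update a k p) (Function.update b k q) with hL
    have hWide (p q : ℝ) (hp : 0 ≤ p) (hq : q ≤ 1) (hpq : σ ≤ q - p) :
        Wide n δ (Function.update a k p) (Function.update b k q) := by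
      refine h.update hδ hkn htriv hp hq ?_
      rw [← hσH]
      exact mul_le_mul_of_nonneg_right hpq hHpos.le
    have hbase (p q : ℝ) (hp : 0 ≤ p) (hq : q ≤ 1) (hpq : σ ≤ q - p) (hpq' : q - p ≤ 4 * σ)
        (hi : IntegralMass w N (L p q)) : Tileable w r N D (L p q) := by
      refine ih hkn.le _ _ (hWide p q hp hq hpq) (fun j hj => ?_) (fun j hkj hj => ?_) hi
      · rw [Function.update_of_ne hj.ne, Function.update_of_ne hj.ne]
        exact htriv j (by omega)
      · have hup : height n (Function.update b k q) (j + 1) = height n b (j + 1) :=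
          height_congr fun i hi _ => Function.update_of_ne (by omega) _ _
        rw [hup]
        rcases hkj.eq_or_lt with rfl | hlt
        · simp only [Function.update_self]
          rw [← hH, ← hσH]
          nlinarith
        · rw [Function.update_of_ne hlt.ne', Function.update_of_ne hlt.ne']
          exact hshort j hlt hj
    have hrec (m : ℕ) : ∀ p q : ℝ, 0 ≤ p → q ≤ 1 → σ ≤ q - p → q - p ≤ m * σ →
        IntegralMass w N (L p q) → Tileable w r N D (L p q) := by
      induction m with
      | zero => intro p q _ _ h1 h2; norm_num at h2; linarith
      | succ m ihm =>
        intro p q hp hq hpq hpqm hi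
        by_cases hsmall : q - p ≤ 4 * σ
        · exact hbase p q hp hq hpq hsmall hi
        push Not at hsmall
        have hnn (x) (hx : x ∈ L p q) : 0 ≤ s (k + 1) x :=
          Wide.nonneg_of_mem_cell hkn (by simp only [Function.update_self]; linarith) hx
        have hmass : 1 / (N : ℝ) ≤ wMass w (L p q ∩
            {x | (p + σ) * s (k + 1) x ≤ s k x ∧ s k x ≤ (p + 2 * σ) * s (k + 1) x}) := by
          obtain ⟨c, hc, hcap, -⟩ := hs.exists_cap_subset_cell hn
            (hWide (p + σ) (p + 2 * σ) (by linarith) (by linarith) (by linarith)) hδ hr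
          refine (hw.mass c hc).trans (wMass_mono hw.nonneg hw.integrable (hcap.trans ?_))
          intro x hx
          have hx0 : 0 ≤ s (k + 1) x :=
            Wide.nonneg_of_mem_cell hkn (by simp only [Function.update_self]; linarith) hx
          obtain ⟨hx1, hx2, hx3⟩ := (mem_cell_update hkn).1 hx
          refine ⟨(mem_cell_update hkn).2 ⟨hx1, ?_, ?_⟩, hx2, hx3⟩
          · nlinarith
          · nlinarith
        obtain ⟨t, ⟨ht1, ht2⟩, ht⟩ := exists_integral_cut hd hw.nonneg hw.integrable hw.pos
          (isClosed_cell _ _ _ _) (s k) (s (k + 1))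
          (hs.sub_smul_ne_zero hkn.le hk (by omega)) (by linarith) hmass hnn
        have e1 : L p q ∩ {x | s k x ≤ t * s (k + 1) x} = L p t := by
          ext x
          simp only [hL, mem_inter_iff, mem_cell_update hkn, mem_ofPred_eq]
          constructor
          · rintro ⟨⟨h1, h2, -⟩, h3⟩
            exact ⟨h1, h2, h3⟩
          · rintro ⟨h1, h2, h3⟩
            have hx0 : 0 ≤ s (k + 1) x := by by_contra hneg; nlinarith
            exact ⟨⟨h1, h2, by nlinarith⟩, h3⟩
        have e2 : L p t ∪ L t q = L p q := by
          ext x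
          simp only [hL, mem_union, mem_cell_update hkn]
          constructor
          · rintro (⟨h1, h2, h3⟩ | ⟨h1, h2, h3⟩)
            · have hx0 : 0 ≤ s (k + 1) x := by by_contra hneg; nlinarith
              exact ⟨h1, h2, by nlinarith⟩
            · have hx0 : 0 ≤ s (k + 1) x := by by_contra hneg; nlinarith
              exact ⟨h1, by nlinarith, h3⟩
          · rintro ⟨h1, h2, h3⟩
            rcases le_total (s k x) (t * s (k + 1) x) with h4 | h4
            · exact Or.inl ⟨h1, h2, h4⟩
            · exact Or.inr ⟨h1, h4, h3⟩
        have e3 : sphMeasure d (L p t ∩ L t q) = 0 :=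
          sphMeasure_pencil_eq_zero hd (s k) (s (k + 1)) t
            (hs.sub_smul_ne_zero hkn.le hk (by omega) t) fun x hx =>
              le_antisymm ((mem_cell_update hkn).1 hx.1).2.2 ((mem_cell_update hkn).1 hx.2).2.1
        rw [e1] at ht
        have hi2 : IntegralMass w N (L t q) :=
          IntegralMass.of_union hw.integrable (isClosed_cell _ _ _ _) e3 (by rwa [e2]) ht
        rw [← e2]
        refine (hbase p t hp (by linarith) (by linarith) (by linarith) ht).union
          (ihm t q (by linarith) hq (by linarith) ?_ hi2) e3
        push_cast at hpqm
        linarith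
    have e : cell n s a b = L 0 1 := by
      rw [hL]
      simp only
      rw [← (htriv k (by omega)).1, ← (htriv k (by omega)).2, Function.update_eq_self,
        Function.update_eq_self]
    have hσ1 : σ ≤ 1 - 0 := by
      have := (h k hkn).2.2
      rw [(htriv k (by omega)).1, (htriv k (by omega)).2] at this
      rw [hσ, div_le_iff₀ hHpos]
      exact this
    obtain ⟨m, hm⟩ := exists_nat_ge (1 / σ)
    rw [e] at hint ⊢
    refine hrec m 0 1 le_rfl le_rfl hσ1 ?_ hint
    rw [div_le_iff₀ hσpos] at hm
    linarith

end Tiling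

section SimplicialCones

variable {n : ℕ} {C : ℝ} {s : ℕ → EuclideanSpace ℝ (Fin d) →ₗ[ℝ] ℝ}

lemma Frame.mono (hs : Frame n C s) {C' : ℝ} (h : C ≤ C') : Frame n C' s where
  bound k hk x := (hs.bound k hk x).trans (mul_le_mul_of_nonneg_right h (norm_nonneg x))
  norm_le x B hB := (hs.norm_le x B hB).trans
    (mul_le_mul_of_nonneg_right h ((abs_nonneg _).trans (hB 0 (Nat.zero_le n))))
  exists_eq := hs.exists_eq

/-- Shearing one coordinate along another increases the distortion by a bounded factor. -/
lemma Frame.update (hs : Frame n C s) {i j : ℕ} (hi : i ≤ n) (hj : j ≤ n) (hij : i ≠ j)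
    {α β : ℝ} (hα : |α| ≤ 3) (hβ : 1 ≤ |β|) (hβ' : |β| ≤ 4) :
    Frame n (8 * C) (Function.update s j (α • s i + β • s j)) where
  bound k hk x := by
    have hC := hs.pos
    have hx := norm_nonneg x
    have hb (k : ℕ) (hk : k ≤ n) : |s k x| ≤ C * ‖x‖ := hs.bound k hk x
    by_cases hkj : k = j
    · subst hkj
      rw [Function.update_self]
      simp only [LinearMap.add_apply, LinearMap.smul_apply, smul_eq_mul]
      refine (abs_add_le _ _).trans ?_
      rw [abs_mul, abs_mul]
      have h1 := mul_le_mul hα (hb i hi) (abs_nonneg _) (by norm_num)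
      have h2 := mul_le_mul hβ' (hb k hk) (abs_nonneg _) (by norm_num)
      nlinarith
    · rw [Function.update_of_ne hkj]
      nlinarith [hb k hk]
  norm_le x B hB := by
    have hB0 : 0 ≤ B := (abs_nonneg _).trans (hB 0 (Nat.zero_le n))
    have hb (k : ℕ) (hk : k ≤ n) (hkj : k ≠ j) : |s k x| ≤ B := by
      simpa [Function.update_of_ne hkj] using hB k hk
    have hbj : |s j x| ≤ 4 * B := by
      have h1 := hB j hj
      rw [Function.update_self] at h1
      simp only [LinearMap.add_apply, LinearMap.smul_apply, smul_eq_mul] at h1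
      have h2 : |β * s j x| ≤ |α * s i x + β * s j x| + |α * s i x| := by
        have := abs_sub (α * s i x + β * s j x) (α * s i x)
        rwa [add_sub_cancel_left] at this
      rw [abs_mul β, abs_mul α (s i x)] at h2
      have h3 := mul_le_mul hα (hb i hi hij) (abs_nonneg _) (by norm_num)
      have h4 := mul_le_mul_of_nonneg_right hβ (abs_nonneg (s j x))
      linarith
    have := hs.norm_le x (8 * B) fun k hk => by
      by_cases hkj : k = j
      · subst hkj; linarith
      · linarith [hb k hk hkj]
    linarith
  exists_eq v := by
    have hβ0 : β ≠ 0 := by rintro rfl; norm_num at hβ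
    obtain ⟨x, hx⟩ := hs.exists_eq (Function.update v j ((v j - α * v i) / β))
    refine ⟨x, fun k hk => ?_⟩
    by_cases hkj : k = j
    · subst hkj
      rw [Function.update_self]
      simp only [LinearMap.add_apply, LinearMap.smul_apply, smul_eq_mul]
      rw [hx i hi, hx k hk, Function.update_self, Function.update_of_ne hij]
      field_simp
      ring
    · rw [Function.update_of_ne hkj, hx k hk, Function.update_of_ne hkj]

lemma mem_cell_succ_update {k : ℕ} (t : EuclideanSpace ℝ (Fin d) →ₗ[ℝ] ℝ)
    {x : EuclideanSpace ℝ (Fin d)} :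
    x ∈ cell (k + 1) (Function.update s (k + 1) t) (fun _ => 0) (fun _ => 1) ↔
      x ∈ cell k s (fun _ => 0) (fun _ => 1) ∧ 0 ≤ s k x ∧ s k x ≤ t x := by
  have e1 (j : ℕ) (hj : j < k) : Function.update s (k + 1) t (j + 1) = s (j + 1) :=
    Function.update_of_ne (by omega) _ _
  have e2 (j : ℕ) (hj : j ≤ k) : Function.update s (k + 1) t j = s j :=
    Function.update_of_ne (by omega) _ _
  constructor
  · intro h
    refine ⟨fun j hj => ?_, ?_⟩
    · have := h j (by omega)
      rwa [e1 j hj, e2 j hj.le] at this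
    · have := h k (by omega)
      rw [Function.update_self, e2 k le_rfl] at this
      simpa using this
  · rintro ⟨h1, h2⟩ j hj
    rcases (Nat.lt_succ_iff.1 hj).eq_or_lt with rfl | hlt
    · rw [Function.update_self, e2 j le_rfl]
      simpa using h2
    · rw [e1 j hlt, e2 j hlt.le]
      exact h1 j hlt

lemma wide_zero_one {δ : ℝ} (hδ : δ ≤ 1) : Wide n δ (fun _ => 0) (fun _ => 1) := by
  intro k _
  simpa [height] using hδ

variable {w : EuclideanSpace ℝ (Fin d) → ℝ} {r : ℝ} {N : ℕ} {D : ℝ}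

/-- The cone between the hyperplanes `s (k + 1) = 0` and `s (k + 1) = -s k` carries mass at
least `1 / N`. -/
lemma Frame.one_div_le_wMass (hw : CapWeight w r N) (hs : Frame n C s)
    (hr : 2 ^ (n + 2) * C ^ 2 * r ≤ 1 / 2) {k : ℕ} (hk : k < n)
    {K : Set (EuclideanSpace ℝ (Fin d))}
    (hK : ∀ x ∈ cell k s (fun _ => 0) (fun _ => 1), 0 ≤ s k x → s k x ≤ s (k + 1) x →
      s (k + 1) x ≤ 2 * s k x → x ∈ K) :
    1 / (N : ℝ) ≤ wMass w K := by
  have hwide : Wide n (1 / 2) (Function.update (fun _ => (0 : ℝ)) k (1 / 2)) (fun _ => 1) := by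
    have := (wide_zero_one (n := n) (by norm_num : (1 / 2 : ℝ) ≤ 1)).update (by norm_num) hk
      (fun _ _ => ⟨rfl, rfl⟩) (p := 1 / 2) (q := 1) (by norm_num) le_rfl (by simp [height]; norm_num)
    rwa [show (fun _ : ℕ => (1 : ℝ)) = Function.update (fun _ => 1) k 1 by simp]
  obtain ⟨c, hc, hcap, -⟩ := hs.exists_cap_subset_cell (by omega) hwide (by norm_num) hr
  refine (hw.mass c hc).trans (wMass_mono hw.nonneg hw.integrable fun x hx => ?_)
  have hx' := hcap hx
  obtain ⟨h1, h2⟩ := hx' k hk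
  simp only [Function.update_self] at h1
  have h0 : 0 ≤ s (k + 1) x := by linarith
  refine hK x (fun j hj => ?_) (by linarith) (by linarith) (by linarith)
  have := hx' j (by omega)
  rwa [Function.update_of_ne hj.ne] at this

/-- A simplicial cone with finitely many remaining free coordinates and of integral mass is
tileable. -/
theorem tileable_cell_zero_one (hd : 2 ≤ d) (hw : CapWeight w r N) (hr0 : 0 < r) {B : ℝ}
    (hr : 2 ^ (n + 2) * (B * 8 ^ n) ^ 2 * r ≤ 1 / 2)
    (hD : D = 16 * n * (B * 8 ^ n) ^ 2 * (2 ^ (n + 2) * (B * 8 ^ n) ^ 2)) (hB : 0 < B)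
    {k : ℕ} (hk : k ≤ n) (hk1 : 1 ≤ k) (s : ℕ → EuclideanSpace ℝ (Fin d) →ₗ[ℝ] ℝ)
    (hs : Frame n (B * 8 ^ k) s)
    (hint : IntegralMass w N (cell k s (fun _ => 0) (fun _ => 1))) :
    Tileable w r N D (cell k s (fun _ => 0) (fun _ => 1)) := by
  induction hk using Nat.decreasingInduction generalizing s with
  | self =>
    have hδ : 0 < 2 ^ (n + 2) * (B * 8 ^ n) ^ 2 * r := by positivity
    exact Wide.tileable hd hw hk1 hs hδ le_rfl (by rw [hD]; linarith) n le_rfl _ _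
      (wide_zero_one (by linarith)) (fun _ _ => ⟨rfl, rfl⟩) (fun j h1 h2 => by omega) hint
  | of_succ k hk ih =>
    have hkn : k ≤ n := hk.le
    have hfr {α β : ℝ} (hα : |α| ≤ 3) (hβ : |β| = 1) :
        Frame n (B * 8 ^ (k + 1)) (Function.update s (k + 1) (α • s k + β • s (k + 1))) :=
      (hs.update hkn hk (by omega) hα hβ.ge (by rw [hβ]; norm_num)).mono
        (by rw [pow_succ]; linarith)
    have hnn (x) (hx : x ∈ cell k s (fun _ => 0) (fun _ => 1)) : 0 ≤ s k x := by
      obtain ⟨j, rfl⟩ : ∃ j, k = j + 1 := ⟨k - 1, by omega⟩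
      exact Wide.nonneg_of_mem_cell (lt_add_one j) (by norm_num) hx
    have hne (p : ℝ) : -s (k + 1) - p • s k ≠ 0 := by
      intro h
      refine hs.sub_smul_ne_zero hk hkn (by omega) (-p) ?_
      rw [show s (k + 1) - (-p) • s k = -(-s (k + 1) - p • s k) by module, h, neg_zero]
    have hmass : 1 / (N : ℝ) ≤ wMass w (cell k s (fun _ => 0) (fun _ => 1) ∩
        {x | 0 * s k x ≤ (-s (k + 1)) x ∧ (-s (k + 1)) x ≤ 1 * s k x}) := by
      have hfr' := (hfr (α := 1) (β := -1) (by norm_num) (by norm_num)).mono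
        (C' := B * 8 ^ n) (by gcongr; · norm_num
                              · omega)
      refine hfr'.one_div_le_wMass hw hr hk fun x hx h1 h2 h3 => ?_
      have e (j : ℕ) (hj : j ≤ k) : Function.update s (k + 1)
          ((1 : ℝ) • s k + (-1 : ℝ) • s (k + 1)) j = s j :=
        Function.update_of_ne (by omega) _ _
      rw [Function.update_self, e k le_rfl] at h2 h3
      simp only [LinearMap.add_apply, LinearMap.smul_apply, smul_eq_mul] at h2 h3
      refine ⟨fun j hj => ?_, ?_, ?_⟩
      · have := hx j hj
        rwa [e j hj.le, e (j + 1) hj] at this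
      · simp only [LinearMap.neg_apply]; linarith
      · simp only [LinearMap.neg_apply]; linarith
    obtain ⟨p, ⟨hp0, hp1⟩, hp⟩ := exists_integral_cut hd hw.nonneg hw.integrable hw.pos
      (isClosed_cell k s (fun _ => 0) (fun _ => 1)) (-s (k + 1)) (s k) hne zero_le_one hmass hnn
    have e1 : cell k s (fun _ => 0) (fun _ => 1) ∩ {x | (-s (k + 1)) x ≤ p * s k x} =
        cell (k + 1) (Function.update s (k + 1) ((1 + p) • s k + (1 : ℝ) • s (k + 1)))
          (fun _ => 0) (fun _ => 1) := by
      ext x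
      simp only [mem_cell_succ_update, mem_inter_iff, mem_ofPred_eq, LinearMap.add_apply,
        LinearMap.smul_apply, smul_eq_mul, LinearMap.neg_apply]
      constructor
      · rintro ⟨h1, h2⟩
        exact ⟨h1, hnn x h1, by linarith⟩
      · rintro ⟨h1, -, h2⟩
        exact ⟨h1, by linarith⟩
    set Q := cell (k + 1) (Function.update s (k + 1) ((1 - p) • s k + (-1 : ℝ) • s (k + 1)))
      (fun _ => 0) (fun _ => 1) with hQ
    have hmQ (x) : x ∈ Q ↔ x ∈ cell k s (fun _ => 0) (fun _ => 1) ∧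
        p * s k x ≤ (-s (k + 1)) x := by
      simp only [hQ, mem_cell_succ_update, LinearMap.add_apply,
        LinearMap.smul_apply, smul_eq_mul, LinearMap.neg_apply]
      constructor
      · rintro ⟨h1, -, h2⟩
        exact ⟨h1, by linarith⟩
      · rintro ⟨h1, h2⟩
        exact ⟨h1, hnn x h1, by linarith⟩
    have e2 : cell k s (fun _ => 0) (fun _ => 1) ∩ {x | (-s (k + 1)) x ≤ p * s k x} ∪ Q =
        cell k s (fun _ => 0) (fun _ => 1) := by
      ext x
      rw [mem_union, hmQ, mem_inter_iff, mem_ofPred_eq, ← and_or_left]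
      exact and_iff_left (le_total _ _)
    have e3 : sphMeasure d
        (cell k s (fun _ => 0) (fun _ => 1) ∩ {x | (-s (k + 1)) x ≤ p * s k x} ∩ Q) = 0 :=
      sphMeasure_pencil_eq_zero hd _ _ p (hne p) fun x hx =>
        le_antisymm hx.1.2 ((hmQ x).1 hx.2).2
    have hi2 : IntegralMass w N Q :=
      IntegralMass.of_union hw.integrable (isClosed_cell _ _ _ _) e3 (by rwa [e2]) hp
    rw [← e2]
    refine Tileable.union ?_ ?_ e3
    · rw [e1] at hp ⊢
      exact ih (by omega) _ (hfr (by rw [abs_le]; constructor <;> linarith) (by norm_num)) hp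
    · exact ih (by omega) _ (hfr (by rw [abs_le]; constructor <;> linarith) (by norm_num)) hi2

/-- A half-space contains a dihedral wedge of integral mass. -/
lemma Frame.exists_wedge (hd : 2 ≤ d) (hn : 1 ≤ n) (hw : CapWeight w r N) (hs : Frame n C s)
    (hr : 2 ^ (n + 2) * (8 * C) ^ 2 * r ≤ 1 / 2) :
    ∃ p ∈ Icc (1 : ℝ) 2, IntegralMass w N
      (cell 1 (Function.update s 1 ((1 + p) • s 0 + (1 : ℝ) • s 1)) (fun _ => 0) (fun _ => 1)) := by
  have hne (p : ℝ) : -s 1 - p • s 0 ≠ 0 := by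
    intro h
    refine hs.sub_smul_ne_zero hn (Nat.zero_le n) (by omega) (-p) ?_
    rw [show s 1 - (-p) • s 0 = -(-s 1 - p • s 0) by module, h, neg_zero]
  have hmass : 1 / (N : ℝ) ≤ wMass w ({x | 0 ≤ s 0 x} ∩
      {x | 1 * s 0 x ≤ (-s 1) x ∧ (-s 1) x ≤ 2 * s 0 x}) := by
    have hfr := hs.update (Nat.zero_le n) hn (by omega) (α := 0) (β := -1) (by norm_num)
      (by norm_num) (by norm_num)
    refine hfr.one_div_le_wMass hw hr hn fun x hx h1 h2 h3 => ?_
    rw [zero_add, Function.update_self, Function.update_of_ne (by norm_num)] at h2 h3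
    rw [Function.update_of_ne (by norm_num)] at h1
    simp only [LinearMap.add_apply, LinearMap.smul_apply, smul_eq_mul] at h2 h3
    refine ⟨h1, ?_, ?_⟩ <;>
    · simp only [LinearMap.neg_apply]; linarith
  obtain ⟨p, hp, hpi⟩ := exists_integral_cut hd hw.nonneg hw.integrable hw.pos
    (isClosed_le continuous_const (s 0).continuous_of_finiteDimensional) (-s 1) (s 0) hne
    one_le_two hmass fun x hx => hx
  refine ⟨p, hp, ?_⟩
  have e : cell 1 (Function.update s 1 ((1 + p) • s 0 + (1 : ℝ) • s 1)) (fun _ => 0)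
      (fun _ => 1) = {x | 0 ≤ s 0 x} ∩ {x | (-s 1) x ≤ p * s 0 x} := by
    ext x
    simp only [mem_cell_succ_update (k := 0), mem_inter_iff, mem_ofPred_eq, LinearMap.add_apply,
      LinearMap.smul_apply, smul_eq_mul, LinearMap.neg_apply]
    constructor
    · rintro ⟨-, h1, h2⟩
      exact ⟨h1, by linarith⟩
    · rintro ⟨h1, h2⟩
      exact ⟨fun j hj => absurd hj (Nat.not_lt_zero j), h1, by linarith⟩
  rwa [e]

/-- The whole space is tileable. -/
theorem Frame.tileable_univ (hd : 2 ≤ d) (hn : 1 ≤ n) (hw : CapWeight w r N) (hr0 : 0 < r)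
    (hs : Frame n C s) {B : ℝ} (hB : B = 64 * C)
    (hr : 2 ^ (n + 2) * (B * 8 ^ n) ^ 2 * r ≤ 1 / 2)
    (hD : D = 16 * n * (B * 8 ^ n) ^ 2 * (2 ^ (n + 2) * (B * 8 ^ n) ^ 2))
    (huniv : IntegralMass w N (univ : Set (EuclideanSpace ℝ (Fin d)))) :
    Tileable w r N D (univ : Set (EuclideanSpace ℝ (Fin d))) := by
  have hC := hs.pos
  have hBpos : 0 < B := by rw [hB]; linarith
  have h8 : (1 : ℝ) ≤ 8 ^ n := one_le_pow₀ (by norm_num)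
  have hscale {A : ℝ} (hA : 0 < A) (hAB : A ≤ B) :
      2 ^ (n + 2) * A ^ 2 * r ≤ 1 / 2 := by
    refine le_trans ?_ hr
    have : A ≤ B * 8 ^ n := by nlinarith
    gcongr
  have h01 : (0 : ℕ) ≤ n := Nat.zero_le n
  set s' := Function.update s 0 ((0 : ℝ) • s 1 + (-1 : ℝ) • s 0) with hs'def
  have hs' : Frame n (8 * C) s' :=
    hs.update hn h01 (by omega) (by norm_num) (by norm_num) (by norm_num)
  have hs'0 (x) : s' 0 x = -s 0 x := by simp [s']
  have hs'1 (x) : s' 1 x = s 1 x := by simp [s']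
  obtain ⟨p, ⟨hp1, hp2⟩, hpi⟩ := hs.exists_wedge hd hn hw (hscale (by linarith) (by linarith))
  obtain ⟨q, ⟨hq1, hq2⟩, hqi⟩ := hs'.exists_wedge hd hn hw (hscale (by linarith) (by linarith))
  set t₁ := Function.update s 1 (p • s 0 + (1 : ℝ) • s 1) with ht₁def
  set t₂ := Function.update t₁ 0 ((-1 : ℝ) • t₁ 1 + (p + q) • t₁ 0) with ht₂def
  have ht₂ : Frame n (8 * (8 * C)) t₂ := by
    have ht₁ : Frame n (8 * C) t₁ := hs.update h01 hn (by omega)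
      (by rw [abs_of_nonneg] <;> linarith) (by norm_num) (by norm_num)
    refine ht₁.update hn h01 (by omega) (by norm_num) ?_ ?_ <;>
    · rw [abs_of_nonneg] <;> linarith
  have ht₂0 (x) : t₂ 0 x = q * s 0 x - s 1 x := by simp [t₂, t₁]; ring
  have ht₂1 (x) : t₂ 1 x = s 1 x + p * s 0 x := by simp [t₂, t₁]; ring
  set Q₁ := cell 1 (Function.update s 1 ((1 + p) • s 0 + (1 : ℝ) • s 1))
    (fun _ => 0) (fun _ => 1) with hQ₁
  set Q₂ := cell 1 (Function.update s' 1 ((1 + q) • s' 0 + (1 : ℝ) • s' 1))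
    (fun _ => 0) (fun _ => 1) with hQ₂
  set Q₃ := cell 1 (Function.update t₂ 1 ((1 : ℝ) • t₂ 0 + (-1 : ℝ) • t₂ 1))
    (fun _ => 0) (fun _ => 1) with hQ₃
  have hcell0 (u : ℕ → EuclideanSpace ℝ (Fin d) →ₗ[ℝ] ℝ) (x) :
      x ∈ cell 0 u (fun _ => 0) (fun _ => 1) := fun j hj => absurd hj (Nat.not_lt_zero j)
  have hm₁ (x) : x ∈ Q₁ ↔ 0 ≤ s 0 x ∧ 0 ≤ s 1 x + p * s 0 x := by
    simp only [hQ₁, mem_cell_succ_update (k := 0), hcell0, true_and, LinearMap.add_apply,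
      LinearMap.smul_apply, smul_eq_mul]
    refine and_congr_right fun _ => ⟨fun h => by linarith, fun h => by linarith⟩
  have hm₂ (x) : x ∈ Q₂ ↔ s 0 x ≤ 0 ∧ q * s 0 x - s 1 x ≤ 0 := by
    simp only [hQ₂, mem_cell_succ_update (k := 0), hcell0, true_and, LinearMap.add_apply,
      LinearMap.smul_apply, smul_eq_mul, hs'0, hs'1]
    refine and_congr ⟨fun h => by linarith, fun h => by linarith⟩
      ⟨fun h => by linarith, fun h => by linarith⟩
  have hm₃ (x) : x ∈ Q₃ ↔ 0 ≤ q * s 0 x - s 1 x ∧ s 1 x + p * s 0 x ≤ 0 := by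
    simp only [hQ₃, mem_cell_succ_update (k := 0), hcell0, true_and, LinearMap.add_apply,
      LinearMap.smul_apply, smul_eq_mul, ht₂0, ht₂1]
    refine and_congr_right fun _ => ⟨fun h => by linarith, fun h => by linarith⟩
  have hne (c : ℝ) : s 1 - c • s 0 ≠ 0 := hs.sub_smul_ne_zero hn h01 (by omega) c
  have hnull₁₂ : sphMeasure d (Q₁ ∩ Q₂) = 0 := by
    refine sphMeasure_pencil_eq_zero hd (s 0) (s 1) 0
      (hs.sub_smul_ne_zero h01 hn (by omega) 0) fun x hx => ?_
    rw [zero_mul]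
    exact le_antisymm ((hm₂ x).1 hx.2).1 ((hm₁ x).1 hx.1).1
  have hnull₃ : sphMeasure d ((Q₁ ∪ Q₂) ∩ Q₃) = 0 := by
    rw [union_inter_distrib_right]
    refine measure_union_null ?_ ?_
    · refine sphMeasure_pencil_eq_zero hd (s 1) (s 0) (-p) (hne (-p)) fun x hx => ?_
      linarith [((hm₁ x).1 hx.1).2, ((hm₃ x).1 hx.2).2]
    · refine sphMeasure_pencil_eq_zero hd (s 1) (s 0) q (hne q) fun x hx => ?_
      linarith [((hm₂ x).1 hx.1).2, ((hm₃ x).1 hx.2).1]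
  have hunion : Q₁ ∪ Q₂ ∪ Q₃ = univ := by
    ext x
    simp only [mem_union, hm₁, hm₂, hm₃, mem_univ, iff_true]
    rcases le_total 0 (s 0 x) with h0 | h0
    · rcases le_total 0 (s 1 x + p * s 0 x) with h1 | h1
      · exact Or.inl (Or.inl ⟨h0, h1⟩)
      · exact Or.inr ⟨by nlinarith, h1⟩
    · rcases le_total (q * s 0 x - s 1 x) 0 with h1 | h1
      · exact Or.inl (Or.inr ⟨h0, h1⟩)
      · exact Or.inr ⟨h1, by nlinarith⟩
  have hi₁₂ : IntegralMass w N (Q₁ ∪ Q₂) := by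
    obtain ⟨k, hk⟩ := hpi
    obtain ⟨l, hl⟩ := hqi
    refine ⟨k + l, ?_⟩
    rw [wMass_union hw.integrable (isClosed_cell _ _ _ _) hnull₁₂, mul_add, hk, hl]
    push_cast
    rfl
  have hi₃ : IntegralMass w N Q₃ :=
    IntegralMass.of_union hw.integrable (isClosed_cell _ _ _ _) hnull₃ (by rwa [hunion]) hi₁₂
  have hfin {u : ℕ → EuclideanSpace ℝ (Fin d) →ₗ[ℝ] ℝ} {A : ℝ} (hu : Frame n A u)
      (hA : A ≤ B * 8) (hi : IntegralMass w N (cell 1 u (fun _ => 0) (fun _ => 1))) :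
      Tileable w r N D (cell 1 u (fun _ => 0) (fun _ => 1)) :=
    tileable_cell_zero_one hd hw hr0 hr hD hBpos hn le_rfl u (hu.mono (by rwa [pow_one])) hi
  rw [← hunion]
  refine Tileable.union (Tileable.union ?_ ?_ hnull₁₂) ?_ hnull₃
  · refine hfin (hs.update h01 hn (by omega) ?_ (by norm_num) (by norm_num)) (by linarith) hpi
    rw [abs_of_nonneg] <;> linarith
  · refine hfin (hs'.update h01 hn (by omega) ?_ (by norm_num) (by norm_num)) (by linarith) hqi
    rw [abs_of_nonneg] <;> linarith
  · exact hfin (ht₂.update h01 hn (by omega) (by norm_num) (by norm_num) (by norm_num))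
      (by linarith) hi₃

end SimplicialCones

/-- The standard coordinates of `ℝ^d`. -/
def stdCoord (d k : ℕ) : EuclideanSpace ℝ (Fin d) →ₗ[ℝ] ℝ :=
  if h : k < d then (EuclideanSpace.proj (𝕜 := ℝ) (⟨k, h⟩ : Fin d)).toLinearMap else 0

lemma stdCoord_apply (i : Fin d) (x : EuclideanSpace ℝ (Fin d)) : stdCoord d i x = x i := by
  simp [stdCoord]

lemma frame_stdCoord (hd : 2 ≤ d) : Frame (d - 1) d (stdCoord d) where
  bound k hk x := by
    rw [stdCoord_apply ⟨k, by omega⟩ x]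
    have h1 := PiLp.norm_apply_le x ⟨k, by omega⟩
    rw [Real.norm_eq_abs] at h1
    have h2 : (1 : ℝ) ≤ d := by exact_mod_cast (by omega : 1 ≤ d)
    nlinarith [norm_nonneg x]
  norm_le x B hB := by
    have hB0 : 0 ≤ B := (abs_nonneg _).trans (hB 0 (Nat.zero_le _))
    have h2 : (1 : ℝ) ≤ d := by exact_mod_cast (by omega : 1 ≤ d)
    refine abs_le_of_sq_le_sq' ?_ (by positivity) |>.2
    rw [EuclideanSpace.norm_sq_eq]
    calc ∑ i, ‖x i‖ ^ 2 ≤ ∑ _i : Fin d, B ^ 2 := by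
          refine Finset.sum_le_sum fun i _ => ?_
          have := hB i (by omega)
          rw [stdCoord_apply] at this
          rw [Real.norm_eq_abs]
          gcongr
      _ = d * B ^ 2 := by simp
      _ ≤ (d * B) ^ 2 := by
          rw [mul_pow]
          nlinarith [mul_nonneg (sub_nonneg.2 h2) (sq_nonneg B), sq_nonneg B]
  exists_eq v := by
    refine ⟨WithLp.toLp 2 fun i => v i, fun k hk => ?_⟩
    rw [stdCoord_apply ⟨k, by omega⟩]

/-- Almost disjoint sets have disjoint interiors when every cap has positive mass. -/
lemma sphInterior_inter_eq_empty {w : EuclideanSpace ℝ (Fin d) → ℝ}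
    (hpos : ∀ x ∈ unitSphere d, ∀ ρ : ℝ, 0 < ρ → 0 < wMass w (cap x ρ))
    {A B : Set (EuclideanSpace ℝ (Fin d))} (h : sphMeasure d (A ∩ B) = 0) :
    sphInterior (A ∩ unitSphere d) ∩ sphInterior (B ∩ unitSphere d) = ∅ := by
  rw [eq_empty_iff_forall_notMem]
  rintro x ⟨⟨⟨-, hxS⟩, ε₁, hε₁, h₁⟩, ⟨-, ε₂, hε₂, h₂⟩⟩
  have hε : 0 < min ε₁ ε₂ / 2 := half_pos (lt_min hε₁ hε₂)
  have hx1 : ‖x‖ = 1 := by simpa [unitSphere] using hxS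
  refine (hpos x hxS _ hε).ne' (setIntegral_measure_zero _ (measure_mono_null ?_ h))
  rintro y ⟨hyS, hy⟩
  have hy1 : ‖y‖ = 1 := by simpa [unitSphere] using hyS
  have hlt : dist y x < min ε₁ ε₂ := by
    rw [dist_comm, dist_eq_norm]
    linarith [norm_sub_le_gdist hx1 hy1]
  exact ⟨(h₁ ⟨hlt.trans_le (min_le_left _ _), hyS⟩).1,
    (h₂ ⟨hlt.trans_le (min_le_right _ _), hyS⟩).1⟩

lemma cap_mono (x : EuclideanSpace ℝ (Fin d)) {ρ₁ ρ₂ : ℝ} (h : ρ₁ ≤ ρ₂) :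
    cap x ρ₁ ⊆ cap x ρ₂ := fun _ hy => ⟨hy.1, hy.2.trans h⟩

/-- Regular convex partitions of the sphere with respect to a weight. -/
theorem regular_convex_partition (d : ℕ) (hd : 2 ≤ d) :
    ∃ cd cd' : ℝ, 0 < cd ∧ 0 < cd' ∧
      ∀ w : EuclideanSpace ℝ (Fin d) → ℝ,
        (∀ x, 0 ≤ w x) →
        Integrable w (sphMeasure d) →
        wMass w (unitSphere d) = 1 →
        (∀ x ∈ unitSphere d, ∀ ρ : ℝ, 0 < ρ → 0 < wMass w (cap x ρ)) →
        ∀ r : ℝ, 0 < r → r ≤ π →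
        ∀ N : ℕ, 0 < N →
          (∀ x ∈ unitSphere d, 1 / (N : ℝ) ≤ wMass w (cap x r)) →
          ∃ (M : ℕ) (R : Fin M → Set (EuclideanSpace ℝ (Fin d)))
            (c : Fin M → EuclideanSpace ℝ (Fin d)),
            (∀ j, IsClosed (R j)) ∧
            (∀ j, GeoConvex (R j)) ∧
            (⋃ j, R j) = unitSphere d ∧
            (∀ i j, i ≠ j → sphInterior (R i) ∩ sphInterior (R j) = ∅) ∧
            ∀ j, c j ∈ unitSphere d ∧
              cap (c j) (cd' * r) ⊆ R j ∧ R j ⊆ cap (c j) (cd * r) ∧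
              ∃ k : ℕ, 0 < k ∧ (N : ℝ) * wMass w (R j) = (k : ℝ) := by
  have hd1 : 1 ≤ d - 1 := by omega
  set B : ℝ := 64 * (d : ℝ) with hB
  set Q : ℝ := 2 ^ (d - 1 + 2) * (B * 8 ^ (d - 1)) ^ 2 with hQ
  set D : ℝ := 16 * (d - 1 : ℕ) * (B * 8 ^ (d - 1)) ^ 2 * Q with hD
  have hdpos : (0 : ℝ) < d := by exact_mod_cast (by omega : 0 < d)
  have hQpos : 0 < Q := by positivity
  have hDnn : 0 ≤ D := by positivity
  refine ⟨D + π * (2 * Q), 1, by positivity, one_pos, ?_⟩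
  intro w hw hwi hw1 hpos r hr _ N hN hmass
  have hcw : CapWeight w r N := ⟨hw, hwi, hN, hmass⟩
  rcases le_or_gt (Q * r) (1 / 2) with hsmall | hlarge
  · have huniv : IntegralMass w N (univ : Set (EuclideanSpace ℝ (Fin d))) := by
      refine ⟨N, ?_⟩
      rw [← wMass_inter_unitSphere, univ_inter, hw1]
      simp
    obtain ⟨F, hF, hFU, hFd, hFt⟩ :=
      (frame_stdCoord hd).tileable_univ hd hd1 hcw hr hB hsmall hD huniv
    have := hF.to_subtype
    let e := Finite.equivFin F
    have ht (j) := hFt _ (e.symm j).2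
    choose c hc hcap hcap' using fun j => (ht j).exists_cap
    refine ⟨Nat.card F, fun j => (e.symm j : Set _) ∩ unitSphere d, c,
      fun j => (ht j).isClosed.inter isClosed_unitSphere, ?_, ?_, ?_, ?_⟩
    · rintro j x ⟨hx, -⟩ y ⟨hy, -⟩ z ⟨hz, t₁, t₂, h₁, h₂, rfl⟩
      exact ⟨(ht j).combination_mem x hx y hy t₁ t₂ h₁ h₂, hz⟩
    · have hU : (⋃ j, ((e.symm j : F) : Set (EuclideanSpace ℝ (Fin d)))) = ⋃₀ F := by
        rw [sUnion_eq_iUnion]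
        exact e.symm.surjective.iUnion_comp fun A : F => (A : Set (EuclideanSpace ℝ (Fin d)))
      rw [← iUnion_inter, hU, hFU, univ_inter]
    · intro i j hij
      refine sphInterior_inter_eq_empty hpos (hFd (e.symm i).2 (e.symm j).2 fun h => hij ?_)
      exact e.symm.injective (Subtype.ext h)
    · intro j
      refine ⟨hc j, ?_, (hcap' j).trans (cap_mono _ ?_), ?_⟩
      · rw [one_mul]
        exact fun x hx => ⟨hcap j hx, hx.1⟩
      · have : 0 ≤ π * (2 * Q) * r := by positivity
        linarith
      · obtain ⟨k, hk⟩ := (ht j).integralMass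
        rw [wMass_inter_unitSphere, hk]
        have hkpos : (0 : ℝ) < k := by
          rw [← hk]
          refine mul_pos (by exact_mod_cast hN) ?_
          exact (hpos (c j) (hc j) r hr).trans_le (wMass_mono hw hwi (hcap j))
        have hkpos : 0 < k := by exact_mod_cast hkpos
        exact ⟨k.toNat, by omega, by exact_mod_cast (Int.toNat_of_nonneg hkpos.le).symm⟩
  · refine ⟨1, fun _ => unitSphere d, fun _ => EuclideanSpace.single ⟨0, by omega⟩ 1,
      fun _ => isClosed_unitSphere, fun _ x _ y _ z hz => hz.1, iUnion_const _,
      fun i j hij => absurd (Subsingleton.elim i j) hij, fun _ => ⟨?_, fun x hx => hx.1, ?_, ?_⟩⟩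
    · simp [unitSphere]
    · intro x hx
      refine ⟨hx, (arccos_le_pi _).trans ?_⟩
      nlinarith [pi_pos, mul_nonneg hDnn hr.le]
    · exact ⟨N, hN, by rw [hw1, mul_one]⟩
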